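/- Let Δ be a set, r a transitive, irreflexive, well-founded binary relation on Δ (every nonempty subset of Δ contains an r-minimal element), and x ∈ Δ a fixed element. Define the relation r₁ by: r₁ u v iff r u v, or [(u = x or r u x) and v ≠ x and not r v x]. Then: (1) r₁ is transitive and irreflexive; (2) r₁ is well-founded; (3) r u v implies r₁ u v for all u, v; (4) for all u, r₁ u x implies r u x. -/

import Mathlib

/-- Given a transitive, irreflexive, well-founded relation `r` on `Δ` and a
fixed `x ∈ Δ`, the relation `r₁ u v := r u v ∨ ((u = x ∨ r u x) ∧ v ≠ x ∧ ¬ r v x)`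
is (1) transitive and irreflexive, (2) well-founded, (3) extends `r`, and
(4) satisfies: `r₁ u x → r u x` for all `u`. -/
theorem modified_relation_properties {Δ : Type*} (r : Δ → Δ → Prop)
    (htrans : ∀ x y z, r x y → r y z → r x z)
    (hirrefl : ∀ x, ¬ r x x)
    (hwf : ∀ U : Set Δ, U.Nonempty → ∃ x ∈ U, ∀ y ∈ U, ¬ r y x)
    (x : Δ) :
    let r₁ : Δ → Δ → Prop := fun u v => r u v ∨ ((u = x ∨ r u x) ∧ v ≠ x ∧ ¬ r v x)
    (∀ a b c, r₁ a b → r₁ b c → r₁ a c) ∧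
    (∀ a, ¬ r₁ a a) ∧
    (∀ U : Set Δ, U.Nonempty → ∃ a ∈ U, ∀ b ∈ U, ¬ r₁ b a) ∧
    (∀ u v, r u v → r₁ u v) ∧
    (∀ u, r₁ u x → r u x) := by
  intro r₁
  refine ⟨?_, ?_, ?_, fun u v h => Or.inl h, ?_⟩
  · rintro a b c (hab | ⟨ha, hbx, hb⟩) (hbc | ⟨hb', hc⟩)
    · exact Or.inl (htrans a b c hab hbc)
    · refine Or.inr ⟨Or.inr ?_, hc⟩
      rcases hb' with rfl | hb'
      · exact hab
      · exact htrans a b x hab hb'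
    · refine Or.inr ⟨ha, ?_, fun hc => hb (htrans b c x hbc hc)⟩
      rintro rfl
      exact hb hbc
    · exact absurd hb' (not_or.mpr ⟨hbx, hb⟩)
  · rintro a (h | ⟨h, hne, hn⟩)
    · exact hirrefl a h
    · exact h.elim hne hn
  · intro U hU
    by_cases hA : (U ∩ {v | v = x ∨ r v x}).Nonempty
    · obtain ⟨a, ⟨haU, haA⟩, hmin⟩ := hwf _ hA
      refine ⟨a, haU, ?_⟩
      rintro b hbU (h | ⟨-, hne, hn⟩)
      · refine hmin b ⟨hbU, Or.inr ?_⟩ h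
        rcases haA with rfl | haA
        · exact h
        · exact htrans b a x h haA
      · exact haA.elim hne hn
    · obtain ⟨a, haU, hmin⟩ := hwf U hU
      refine ⟨a, haU, ?_⟩
      rintro b hbU (h | ⟨hb, -⟩)
      · exact hmin b hbU h
      · exact hA ⟨b, hbU, hb⟩
  · rintro u (h | ⟨-, hne, -⟩)
    · exact h
    · exact absurd rfl hne
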